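/- Every set S of exactly 8 points in the plane in general position admits 4 pairwise edge-disjoint plane spanning trees. -/

import Mathlib

/-- Points in the plane. -/
abbrev Pt : Type := ℝ × ℝ

/-- A finite point set is in general position if no three of its points are collinear. -/
def GenPos (S : Finset Pt) : Prop :=
  ∀ p ∈ S, ∀ q ∈ S, ∀ r ∈ S, p ≠ q → p ≠ r → q ≠ r →
    ¬ Collinear ℝ ({p, q, r} : Set Pt)

/-- A geometric graph on `S` (a simple graph on the points of `S`, edges drawn as
straight segments) is plane if the open segments of any two distinct edges are disjoint. -/
def IsPlaneGraph {S : Finset Pt} (G : SimpleGraph {x // x ∈ S}) : Prop :=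
  ∀ a b c d : {x // x ∈ S}, G.Adj a b → G.Adj c d → s(a, b) ≠ s(c, d) →
    openSegment ℝ (a : Pt) (b : Pt) ∩ openSegment ℝ (c : Pt) (d : Pt) = ∅

/-- A plane spanning tree of `S`: a tree on all points of `S` drawn without crossings. -/
def IsPlaneSpanningTree {S : Finset Pt} (G : SimpleGraph {x // x ∈ S}) : Prop :=
  G.IsTree ∧ IsPlaneGraph G

/-- A plane spanning path of `S`: a plane spanning tree in which every vertex
has degree at most two (i.e. a plane Hamiltonian path). -/
def IsPlaneSpanningPath {S : Finset Pt} (G : SimpleGraph {x // x ∈ S}) : Prop :=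
  IsPlaneSpanningTree G ∧
    ∀ v a b c : {x // x ∈ S}, G.Adj v a → G.Adj v b → G.Adj v c →
      (a = b ∨ a = c ∨ b = c)

/-- The open segment spanned by an unordered pair of points. -/
def segOpen (e : Sym2 Pt) : Set Pt :=
  Sym2.lift ⟨fun a b => openSegment ℝ a b, fun a b => openSegment_symm ℝ a b⟩ e

/-- `F` is a crossing family in `S`: a set of nondegenerate segments with endpoints
in `S`, any two of which cross (their open segments intersect). -/
def IsCrossingFamily (S : Finset Pt) (F : Finset (Sym2 Pt)) : Prop :=
  (∀ e ∈ F, ¬ e.IsDiag ∧ ∀ x ∈ e, x ∈ S) ∧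
  (∀ e ∈ F, ∀ f ∈ F, e ≠ f → (segOpen e ∩ segOpen f).Nonempty)

/-- `x` lies strictly to the left of the directed line from `p` to `q`. -/
def leftOf (p q x : Pt) : Prop :=
  0 < (q.1 - p.1) * (x.2 - p.2) - (q.2 - p.2) * (x.1 - p.1)

/-- `x` lies strictly to the right of the directed line from `p` to `q`. -/
def rightOf (p q x : Pt) : Prop :=
  (q.1 - p.1) * (x.2 - p.2) - (q.2 - p.2) * (x.1 - p.1) < 0

/-- The double star on `S` associated with the directed edge `pq`: the edge `pq`,
the edges from `p` to all points strictly left of the directed line `pq`, and the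
edges from `q` to all points strictly right of it. -/
def doubleStar (S : Finset Pt) (p q : Pt) : SimpleGraph {x // x ∈ S} :=
  SimpleGraph.fromRel fun a b =>
    ((a : Pt) = p ∧ (b : Pt) = q) ∨
    ((a : Pt) = p ∧ leftOf p q (b : Pt)) ∨
    ((a : Pt) = q ∧ rightOf p q (b : Pt))

/-- The regular wheel configuration `W_{2n}`: `2n-1` points regularly spaced on the
unit circle together with its center. -/
noncomputable def wheel (n : ℕ) : Finset Pt :=
  insert ((0 : ℝ), (0 : ℝ)) <| (Finset.range (2 * n - 1)).image fun j : ℕ =>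
    (Real.cos (2 * Real.pi * (j : ℝ) / ((2 * n - 1 : ℕ) : ℝ)),
     Real.sin (2 * Real.pi * (j : ℝ) / ((2 * n - 1 : ℕ) : ℝ)))

namespace FourTrees

/-- Certificates: a decision tree over orientations of triples. -/
inductive Tr where
  | L (c : ℕ) : Tr
  | B (t : ℕ) (a b : Tr) : Tr
  | U (n : ℕ) (t : Tr) : Tr

open Tr

/-- bit test, in a form the kernel evaluates quickly -/
def tb (K i : ℕ) : Bool := Nat.beq (Nat.land 1 (Nat.shiftRight K i)) 1

/-- add a bit -/
def ins (K i : ℕ) : ℕ := Nat.lor K (Nat.shiftLeft 1 i)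

theorem tb_eq (K i : ℕ) : tb K i = K.testBit i := by
  have h : tb K i = decide ((1 &&& (K >>> i)) = 1) := by
    rw [Bool.eq_iff_iff]; simp only [tb, decide_eq_true_eq]; exact Nat.beq_eq ▸ Iff.rfl
  rw [h, Nat.testBit]
  have h2 : 1 &&& (K >>> i) = (K >>> i) % 2 := by rw [Nat.and_comm, Nat.and_one_is_mod]
  rw [h2]
  rcases Nat.mod_two_eq_zero_or_one (K >>> i) with h | h <;> simp [h]

theorem tb_ins (K i j : ℕ) : tb (ins K i) j = true ↔ tb K j = true ∨ i = j := by
  rw [tb_eq, tb_eq]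
  have : ins K i = K ||| 2 ^ i := by
    show K ||| (1 <<< i) = _
    rw [Nat.one_shiftLeft]
  rw [this, Nat.testBit_or, Nat.testBit_two_pow]
  simp

/-- code of a triple -/
def tc (a b c : ℕ) : ℕ := Nat.add (Nat.mul 64 a) (Nat.add (Nat.mul 8 b) c)

/-- colour of the edge `u < v` -/
def colr (col u v : ℕ) : ℕ :=
  Nat.land 3 (Nat.shiftRight col (Nat.mul 2 (Nat.add (Nat.mul 8 u) v)))

/-- positive literal -/
def pl (t : ℕ) : ℕ := Nat.add (Nat.mul 2 t) 1
/-- negative literal -/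
def nl (t : ℕ) : ℕ := Nat.mul 2 t

/-- the three consecutive orientations of the quadruple `w x y z` left when dropping the `om`-th -/
def tri (om w x y z : ℕ) : ℕ × ℕ × ℕ :=
  match om with
  | 0 => (tc w x z, tc w y z, tc x y z)
  | 1 => (tc w x y, tc w y z, tc x y z)
  | 2 => (tc w x y, tc w x z, tc x y z)
  | _ => (tc w x y, tc w x z, tc w y z)

/-- literal of triple `t` with sign bit `s` -/
def lt (t s : ℕ) : ℕ := Nat.add (Nat.mul 2 t) s

/-- no crossing inside the quadruple `w < x < y < z`, certified by `K` -/
def quadOK (K col w x y z : ℕ) : Bool :=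
  (!(Nat.beq (colr col w y) (colr col x z)) ||
    ((tb K (pl (tc w x y)) || tb K (pl (tc w x z)) || tb K (pl (tc w y z)) || tb K (pl (tc x y z))) &&
     (tb K (nl (tc w x y)) || tb K (nl (tc w x z)) || tb K (nl (tc w y z)) || tb K (nl (tc x y z)))))
  &&
  (!(Nat.beq (colr col w z) (colr col x y)) ||
    ((tb K (pl (tc w x y)) || tb K (pl (tc w x z)) || tb K (nl (tc w y z)) || tb K (nl (tc x y z))) &&
     (tb K (nl (tc w x y)) || tb K (nl (tc w x z)) || tb K (pl (tc w y z)) || tb K (pl (tc x y z)))))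

/-- all increasing quadruples -/
def quads : List (ℕ × ℕ × ℕ × ℕ) :=
  [0, 1, 2, 3, 4].flatMap fun w => ([1, 2, 3, 4, 5].filter (Nat.blt w)).flatMap fun x =>
    ([2, 3, 4, 5, 6].filter (Nat.blt x)).flatMap fun y =>
      ([3, 4, 5, 6, 7].filter (Nat.blt y)).map fun z => (w, x, y, z)

/-- all edges -/
def edges : List (ℕ × ℕ) :=
  [0, 1, 2, 3, 4, 5, 6].flatMap fun u =>
    ([1, 2, 3, 4, 5, 6, 7].filter (Nat.blt u)).map fun v => (u, v)

/-- one pass of growing the component -/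
def grow (col k : ℕ) : List (ℕ × ℕ) → ℕ → ℕ
  | [], R => R
  | (u, v) :: l, R =>
    bif Nat.beq (colr col u v) k && (tb R u || tb R v) then grow col k l (ins (ins R u) v)
    else grow col k l R

/-- connectivity check -/
def conn (col k : ℕ) : ℕ → ℕ → Bool
  | 0, R => Nat.beq R 255
  | n + 1, R => Nat.beq R 255 || conn col k n (grow col k edges R)

def leafOK (K col : ℕ) : Bool :=
  conn col 0 7 1 && conn col 1 7 1 && conn col 2 7 1 && conn col 3 7 1 &&
    quads.all fun q => quadOK K col q.1 q.2.1 q.2.2.1 q.2.2.2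

def unitOK (K i j k f s : ℕ) : Bool × ℕ :=
  match f with
  | 0 => (tb K (lt j s) && tb K (lt k (1 - s)), lt i s)
  | 1 => (tb K (lt i s) && tb K (lt k s), lt j s)
  | _ => (tb K (lt i (1 - s)) && tb K (lt j s), lt k s)

def check : Tr → ℕ → Bool
  | L c, K => leafOK K c
  | B t a b, K => check a (ins K (pl t)) && check b (ins K (nl t))
  | U n t, K =>
    let q := n / 32
    let w := q / 512
    let x := q / 64 % 8
    let y := q / 8 % 8
    let z := q % 8
    let T := tri (n / 8 % 4) w x y z
    let r := unitOK K T.1 T.2.1 T.2.2 (n / 2 % 4) (n % 2)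
    Nat.blt w x && Nat.blt x y && Nat.blt y z && r.1 && check t (ins K r.2)

/-- initial knowledge: triples containing the extreme point `0` are positive -/
def K0 : ℕ := (edges.filter fun e => Nat.blt 0 e.1).foldl (fun K e => ins K (pl (tc 0 e.1 e.2))) 0
def cert : Tr :=
 B 183
 (B 166
 (U 42747 <| B 86
 (U 21699 <| U 22251 <| U 22259 <| U 26363 <| B 158
 (U 21443 <| U 24315 <| U 40699 <| B 174
 (U 21955 <| U 28411 <| U 44795 <| L 3894222644297811755960743200076116)
 (U 21969 <| U 40388 <| U 40401 <| U 42436 <| U 42449 <| U 21411 <| U 21667 <| B 175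
 (L 3894287017708761659296027467885264)
 (L 2596222706293133040748837451358048)))
 (U 21457 <| U 40133 <| U 40144 <| U 40173 <| U 40685 <| B 94
 (U 24307 <| B 110
 (U 28411 <| B 159
 (B 239
 (U 40419 <| L 3894222644297811755960743200076116)
 (L 2596222705669778575280720254626816))
 (B 239
 (U 40432 <| L 2596222705669778575280720254626816)
 (U 24041 <| U 40418 <| U 42468 <| U 42481 <| U 44773 <| U 44784 <| U 58865 <| U 61168 <| U 77552 <| U 21435 <| U 21667 <| L 24758970793423047755239063320)))
 (U 21956 <| U 21969 <| U 24004 <| U 24017 <| U 26052 <| U 26065 <| U 28397 <| U 42449 <| U 58833 <| B 175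
 (U 21987 <| B 159
 (L 3894287017708761659296027467885264)
 (U 40421 <| U 40432 <| B 303
 (U 77539 <| L 2596153381499824321715782650225000)
 (L 2596222706293133040748837451358048)))
 (U 42468 <| B 157
 (L 2596222706293133040748837451358048)
 (L 2596222706293133328974815556558688))))
 (U 23760 <| B 175
 (U 21987 <| B 110
 (U 24005 <| U 24016 <| U 40400 <| L 2596173188068216023340435107800064)
 (U 21956 <| U 21969 <| U 26052 <| U 26065 <| U 42449 <| B 157
 (U 21411 <| U 24059 <| L 3894287017708761659296027467885264)
 (L 1298079167583910850875753542751188)))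
 (U 22001 <| U 42468 <| U 42481 <| U 44773 <| U 44784 <| U 58865 <| U 21667 <| B 110
 (U 24005 <| U 24016 <| U 28403 <| U 40392 <| U 61171 <| L 2596173188068216023340435107800064)
 (B 157
 (U 21411 <| U 24012 <| U 40428 <| L 1298123732235294535569738783839616)
 (L 19807833991611864022690844328))))))
 (U 21712 <| B 158
 (U 21456 <| U 40699 <| B 174
 (U 21968 <| U 44795 <| B 95
 (B 119
 (B 103
 (B 111
 (L 49517998268574681180162541908)
 (U 24036 <| U 24049 <| U 26084 <| U 26097 <| U 28389 <| U 28400 <| U 40425 <| U 42473 <| U 61168 <| U 77552 <| L 1298074215143730269688246140203236))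
 (U 23780 <| U 23793 <| U 26341 <| U 26352 <| U 40169 <| U 59120 <| B 165
 (U 40123 <| B 303
 (U 26096 <| L 1298094022335472329269184637763136)
 (U 26082 <| U 28389 <| U 28400 <| U 58850 <| U 24049 <| L 2596148430457460544411267513734136))
 (U 21666 <| U 23724 <| U 42477 <| L 24759424156314057422593361904)))
 (U 24292 <| U 24305 <| B 239
 (U 24035 <| U 28388 <| U 28401 <| U 61169 <| B 102
 (L 1298084118361808558291545795630512)
 (U 23748 <| U 26053 <| U 26064 <| U 40137 <| U 58832 <| U 59130 <| L 3894252355425432890493311179065720))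
 (U 24049 <| U 40425 <| B 231
 (U 23779 <| U 26340 <| U 26353 <| U 58852 <| U 58865 <| U 59121 <| U 23715 <| U 40099 <| B 238
 (U 24003 <| L 1298084118361808558291545795630512)
 (U 58820 <| L 1298148491206072033766884157431656))
 (U 23793 <| U 40169 <| L 1298148491036074766706279523064832))))
 (B 247
 (U 24304 <| B 231
 (U 23792 <| B 239
 (U 24048 <| L 4951873509501647869213452504)
 (U 24034 <| U 40425 <| U 58852 <| U 58865 <| U 61157 <| U 61168 <| U 77552 <| U 24002 <| U 40099 <| L 2596173188899349353789429888583088))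
 (U 23778 <| U 59109 <| U 59120 <| U 23746 <| B 239
 (U 24048 <| U 58853 <| U 58864 <| U 23714 <| L 4951873495882765069944138516)
 (U 24034 <| U 61157 <| U 61168 <| U 24002 <| L 9903690322286855293803495204)))
 (U 24290 <| B 239
 (U 24048 <| U 61156 <| U 61169 <| B 231
 (U 23792 <| U 59108 <| U 59121 <| L 24759990824367172617463932912)
 (U 23778 <| U 58853 <| U 58864 <| U 77553 <| U 23714 <| L 3894287017708761659296027467885264))
 (U 24034 <| U 40425 <| B 103
 (U 23781 <| U 23792 <| U 26084 <| U 26097 <| U 26340 <| U 26353 <| U 42473 <| B 94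
 (B 93
 (L 1298148491036074766706279523064832)
 (U 24029 <| L 1298084118361808558291545795630512))
 (L 3894282065684147455216030510487340))
 (L 49517998268574681180162541908)))))
 (U 21954 <| U 40388 <| U 40401 <| U 42436 <| U 42449 <| U 44781 <| B 111
 (U 28387 <| B 95
 (B 103
 (L 1298094022127689789462610121391968)
 (U 21728 <| U 21989 <| U 23780 <| U 23793 <| U 26085 <| U 26096 <| U 26341 <| U 26352 <| L 1298094022335472329269184637763136))
 (U 21472 <| U 21989 <| U 22000 <| U 24037 <| U 24048 <| U 24293 <| U 24304 <| B 103
 (U 23781 <| U 23792 <| L 4951873509501647869213452504)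
 (U 26085 <| U 26096 <| U 26341 <| U 26352 <| L 49517941587206371381767896964)))
 (B 93
 (U 24044 <| B 101
 (L 1298074215143730269688246140203236)
 (U 21664 <| U 22010 <| U 23716 <| U 23729 <| U 26106 <| U 58874 <| L 2596173188710450947204600766201440))
 (U 24018 <| U 24058 <| B 229
 (U 23728 <| B 239
 (U 40419 <| U 58875 <| U 61155 <| L 4951873509501647869213452504)
 (L 2596173188899349353789429888583088))
 (U 23714 <| U 26066 <| U 40105 <| U 58834 <| B 119
 (L 1298133636681192865347456063247560)
 (L 1298094022127689789462610121391968))))))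
 (U 21442 <| U 40133 <| U 40144 <| U 40173 <| U 40685 <| U 21378 <| B 238
 (U 24016 <| U 40400 <| U 61179 <| B 175
 (B 85
 (U 21693 <| U 21995 <| U 22003 <| U 22243 <| U 26107 <| L 2596173188068216023340435107800064)
 (L 1298074215427079464469034387427968))
 (U 42468 <| U 42481 <| U 44773 <| U 44784 <| U 58857 <| U 77552 <| U 21954 <| B 101
 (L 3894262258379066366048877303316296)
 (U 21664 <| U 21994 <| L 2596158332806620805881514342505856)))
 (U 24002 <| U 40386 <| U 42436 <| U 42449 <| U 44781 <| U 58833 <| B 111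
 (U 28387 <| B 85
 (U 21667 <| U 22011 <| U 26107 <| B 157
 (U 21411 <| U 24059 <| L 39614477946221120003822910792)
 (B 175
 (L 1298079167583910850875753542751188)
 (L 19807833991611864022690844328)))
 (B 93
 (U 21413 <| U 23715 <| U 26107 <| L 39614477946221120003822910792)
 (U 24045 <| L 49517998266484999959009610068)))
 (B 87
 (U 21731 <| U 21988 <| U 22001 <| U 22243 <| U 26084 <| U 26097 <| B 157
 (U 21411 <| L 39614477946221120003822910792)
 (L 19807833991611864022690844328))
 (B 95
 (U 21477 <| U 23779 <| U 24036 <| U 24049 <| U 24291 <| U 40433 <| L 39614477946221120003822910792)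
 (L 2596158332806620805881514342505856)))))))
 (U 42733 <| B 158
 (U 40132 <| U 40145 <| U 40699 <| B 87
 (U 21475 <| U 22243 <| B 101
 (B 302
 (U 26059 <| U 28411 <| U 42448 <| U 58832 <| U 77563 <| U 21665 <| U 21673 <| U 23713 <| U 23721 <| B 231
 (U 40163 <| U 42467 <| L 9903690322286855293803495204)
 (L 3894291969317805235269317692490292))
 (U 42434 <| U 44781 <| U 58818 <| U 40401 <| B 175
 (U 21987 <| U 26107 <| B 85
 (U 21411 <| B 167
 (L 3894287017708761659296027467885264)
 (U 40164 <| U 42469 <| U 42480 <| U 58864 <| L 1298123733255309627038755672086528))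
 (U 21669 <| U 21680 <| U 21714 <| U 21741 <| U 21954 <| L 1298094022127689789462610121391968))
 (U 22001 <| U 40420 <| U 21411 <| B 167
 (U 21731 <| U 42468 <| U 42481 <| L 2596222706293133040748837451358048)
 (U 21745 <| U 21379 <| B 111
 (U 26107 <| L 2596148430457460544411267513734136)
 (U 28400 <| L 34663114459793573630940607140)))))
 (B 231
 (U 23779 <| U 26101 <| U 26109 <| U 40163 <| U 42467 <| U 58851 <| U 59107 <| B 102
 (U 21697 <| U 21705 <| U 23745 <| U 23753 <| U 26077 <| L 1298094022467698590857976685330064)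
 (B 302
 (U 42448 <| U 58832 <| L 2596222706028671006048551457287680)
 (U 26050 <| U 42434 <| U 58818 <| U 40401 <| B 94
 (U 23761 <| U 24017 <| B 83
 (U 21395 <| U 21427 <| U 21459 <| U 21668 <| L 49518791618289462031843083240)
 (L 2596183091588531026912395187512324))
 (U 21440 <| L 9903690322286855293803495204))))
 (U 23793 <| U 23724 <| B 84
 (U 21676 <| B 111
 (L 2596188043745359891272260219109216)
 (U 21988 <| U 22001 <| U 24036 <| U 24049 <| U 26106 <| U 26352 <| U 28389 <| U 28400 <| U 44784 <| L 59422066365119908988838791424))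
 (U 21392 <| U 21690 <| U 21706 <| U 21714 <| U 21749 <| U 21757 <| U 22013 <| U 26093 <| B 302
 (U 42448 <| L 1298123733255309627038755672086528)
 (L 49518659387704540193285523792)))))
 (U 21488 <| U 22256 <| U 21698 <| B 302
 (U 26064 <| U 42448 <| U 58832 <| U 77563 <| B 231
 (U 40163 <| U 58851 <| U 21744 <| L 1298103925799115836722721541127704)
 (B 175
 (U 22000 <| L 24759424156314057422593361904)
 (U 21986 <| U 26080 <| U 40420 <| U 40433 <| U 42464 <| U 44773 <| U 44784 <| U 61168 <| U 21954 <| L 49518791611948287927967045512)))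
 (U 26050 <| U 42434 <| U 44781 <| U 58818 <| U 40401 <| B 103
 (U 21733 <| U 21744 <| U 26339 <| B 111
 (U 21989 <| U 22000 <| B 165
 (B 95
 (L 1298094022127689789462610121391968)
 (U 23781 <| U 23792 <| U 24037 <| U 24048 <| U 24293 <| U 24304 <| L 1298074215427079464469034387427968))
 (U 21666 <| U 40100 <| B 92
 (U 23803 <| L 14856073832740932631222310412)
 (U 23762 <| L 2596178139828364445732949681307428)))
 (U 26084 <| U 26097 <| U 42481 <| B 95
 (U 24036 <| U 24049 <| L 1298074215143730269688246140203236)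
 (U 23781 <| U 58865 <| L 2596173188899349353789429888583088)))
 (B 239
 (U 40419 <| U 61155 <| U 22000 <| B 92
 (U 23788 <| U 58853 <| U 58864 <| U 26096 <| L 49518659387704540193285523792)
 (U 21376 <| U 23762 <| U 23802 <| L 1298133636681192865347456063247560))
 (B 231
 (U 23776 <| U 24034 <| U 40163 <| U 58852 <| U 58865 <| U 40099 <| L 2596173188899349353789429888583088)
 (B 111
 (U 21989 <| U 22000 <| U 24033 <| U 26085 <| U 26096 <| U 28387 <| U 58856 <| L 49518659387704540193285523792)
 (L 49518791611948287927967045512)))))))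
 (U 40685 <| B 174
 (U 40389 <| U 40400 <| U 42437 <| U 42448 <| U 44795 <| U 61179 <| U 77563 <| B 86
 (U 21457 <| U 21713 <| U 21955 <| U 22251 <| U 22259 <| U 28411 <| B 231
 (B 95
 (U 23779 <| B 93
 (U 21409 <| U 24019 <| B 102
 (B 156
 (U 40171 <| U 40179 <| L 9903690322286855293803495204)
 (L 2596222705669778575280720254626816))
 (U 23748 <| U 26064 <| U 58832 <| L 2596222706028671006048551457287680))
 (B 229
 (U 23728 <| U 40104 <| U 58835 <| L 2596173188068216023340435107800064)
 (U 23714 <| L 49518130484675952678817286676)))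
 (U 21476 <| U 23792 <| U 24048 <| U 40176 <| B 101
 (U 21665 <| U 26067 <| U 26099 <| L 2596173188068216023340435107800064)
 (L 2596148430249671951704125036587712)))
 (U 58864 <| U 59120 <| B 95
 (U 23793 <| B 101
 (U 21665 <| U 23713 <| U 24019 <| B 156
 (L 3894291969317805235269317692490292)
 (U 40178 <| L 3894272162182723502774447013658512))
 (L 1298123733255309627038755672086528))
 (U 23778 <| U 24304 <| U 26096 <| U 26352 <| L 4952950199908360631419447920)))
 (U 21442 <| U 21698 <| U 21968 <| U 24016 <| U 26064 <| L 49517941587206371381767896964))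
 (U 44781 <| B 86
 (U 21457 <| U 21713 <| U 21969 <| U 22251 <| U 22259 <| B 95
 (B 101
 (B 110
 (U 26075 <| U 26355 <| U 28403 <| B 94
 (L 3894277114093998533487016116508128)
 (U 23749 <| U 23760 <| U 23789 <| U 24005 <| U 24016 <| U 24045 <| U 40136 <| U 40392 <| L 2596148430457460544411267513734136))
 (U 26060 <| B 175
 (U 21987 <| U 26107 <| B 157
 (U 21411 <| U 40443 <| B 167
 (L 3894287017708761659296027467885264)
 (U 40164 <| U 42469 <| U 42480 <| U 58864 <| U 59120 <| L 49517714926513448544669555696))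
 (U 40429 <| B 229
 (U 40112 <| U 58875 <| L 44567031455239170942484630476)
 (U 23713 <| U 40098 <| L 2596222706293133040748837451358048)))
 (B 159
 (U 40420 <| U 40433 <| U 21411 <| B 167
 (U 21731 <| U 42468 <| U 42481 <| L 2596222706293133040748837451358048)
 (U 40164 <| U 40177 <| U 59120 <| U 21379 <| L 34663114459793573630940607140))
 (B 103
 (B 94
 (U 24004 <| U 24017 <| L 3894252354820969043818251954469488)
 (B 238
 (U 24008 <| U 24053 <| U 24061 <| U 40392 <| U 58817 <| U 58825 <| U 58875 <| U 23728 <| U 40112 <| L 2596148430457460544411267513734136)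
 (B 229
 (B 239
 (U 40424 <| U 40112 <| L 1298113829905012354621600020039672)
 (U 24049 <| L 24758970793423047755239063320))
 (U 23713 <| U 23721 <| U 23764 <| U 23772 <| B 231
 (U 40176 <| U 40114 <| L 2596222706293133328974815556558688)
 (U 40162 <| L 1298113829338334573664140384012280)))))
 (U 23780 <| U 23793 <| U 26100 <| U 26108 <| U 26352 <| U 58850 <| U 59120 <| U 61168 <| U 23739 <| L 74277195718078686471486722772)))))
 (U 21668 <| B 159
 (B 167
 (U 21731 <| U 26101 <| U 26109 <| U 42467 <| L 49517998268574681180162541908)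
 (U 40164 <| U 40177 <| U 59120 <| U 21379 <| U 23724 <| B 111
 (L 2596188043745359891272260219109216)
 (U 21988 <| U 24036 <| U 24049 <| U 26106 <| U 26352 <| U 28400 <| L 59422066365119908988838791424)))
 (B 92
 (U 23724 <| B 111
 (B 231
 (U 23779 <| U 40176 <| B 230
 (U 23755 <| U 23763 <| U 26077 <| L 3894277114093998533487016116508128)
 (L 2596188043745359891272260219109216))
 (U 40162 <| U 59120 <| L 3894262258379066870496563201851284))
 (U 21988 <| U 24036 <| U 24049 <| U 26106 <| U 26352 <| U 28400 <| U 58874 <| U 59120 <| L 1298113829338334573664140384012280))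
 (U 21380 <| U 23738 <| U 23797 <| U 23805 <| U 24053 <| U 24061 <| U 26093 <| U 40122 <| B 110
 (L 2596222706293133040748837451358048)
 (U 24026 <| U 26074 <| B 175
 (L 44567031455239170942484630476)
 (U 42464 <| L 1298148491036071668176958181649412))))))
 (U 21476 <| U 24304 <| B 101
 (B 175
 (U 21987 <| U 24037 <| U 24048 <| U 26107 <| U 40432 <| U 23717 <| U 23728 <| U 23781 <| U 40112 <| B 238
 (U 58843 <| L 2596148430457460544411267513734136)
 (U 24002 <| L 24759594145366451152858707600))
 (B 231
 (U 23792 <| U 40176 <| U 23725 <| B 110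
 (U 24005 <| U 24016 <| U 26075 <| U 26355 <| U 28403 <| U 40392 <| U 61171 <| L 2596148430457460544411267513734136)
 (L 19807833991611864022690844328))
 (U 23778 <| U 26100 <| U 26108 <| U 26352 <| U 40162 <| U 58850 <| U 59120 <| U 61168 <| L 2596173188068209465976780414317756)))
 (U 21668 <| B 111
 (U 24037 <| U 24048 <| U 26093 <| U 40432 <| B 167
 (U 21731 <| U 23781 <| U 40176 <| U 42467 <| B 110
 (L 2596148430249671951704125036587712)
 (U 26074 <| L 44567031455239170942484630476))
 (B 102
 (U 23749 <| U 23760 <| U 26077 <| U 26355 <| U 40136 <| U 59123 <| L 2596148430457460544411267513734136)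
 (L 1298094022297697577011663974958976)))
 (U 21988 <| U 26106 <| U 26352 <| U 28400 <| U 42490 <| B 93
 (U 23716 <| U 23729 <| U 23756 <| U 24012 <| L 29711070965202710154305383488)
 (U 21412 <| L 3894282065967494199894859396942332)))))
 (U 21442 <| U 21698 <| U 21954 <| B 111
 (U 28387 <| B 85
 (U 22011 <| B 95
 (B 103
 (L 3894277114093998533487016116508128)
 (U 21732 <| U 21745 <| U 23780 <| U 23793 <| U 26085 <| U 26096 <| U 42480 <| U 58864 <| B 156
 (L 2596188043745359891272260219109216)
 (U 21385 <| U 40178 <| L 3894262258379066870496563201851284)))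
 (U 21476 <| U 21489 <| U 24037 <| U 24048 <| U 40432 <| B 103
 (U 23781 <| U 23792 <| U 40176 <| L 2596222705669778575280720254626816)
 (U 21732 <| U 21745 <| U 26085 <| U 26096 <| U 42480 <| L 1298094022297697577011663974958976)))
 (U 21997 <| B 93
 (U 21413 <| U 21424 <| U 24059 <| U 40443 <| B 103
 (B 167
 (L 3894222644297811755960743200076116)
 (U 21729 <| U 21737 <| U 40164 <| U 40177 <| U 42469 <| U 42480 <| U 58864 <| U 21379 <| U 21666 <| L 2596188043745359891272260219109216))
 (U 23780 <| U 23793 <| U 26085 <| U 26096 <| U 40177 <| U 58864 <| B 167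
 (U 21736 <| L 14856073832740932631222310412)
 (U 42480 <| L 34663114465774425132181274772)))
 (U 24045 <| B 101
 (U 21669 <| U 21680 <| U 23717 <| U 23728 <| U 26060 <| U 26107 <| B 157
 (U 40396 <| L 2596207851107100875300315442732720)
 (U 40112 <| L 1298143539597037104903069121908168))
 (L 3894252354632071574179783115849616))))
 (B 87
 (U 21988 <| U 22001 <| U 22243 <| B 93
 (U 24012 <| U 24044 <| B 101
 (L 3894252354632071574179783115849616)
 (U 21668 <| U 21681 <| U 23716 <| U 23729 <| U 23756 <| U 26106 <| L 74277195718078686471486722772))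
 (U 21412 <| U 21425 <| U 24058 <| U 40442 <| B 101
 (U 23717 <| U 23728 <| U 26060 <| U 26092 <| U 40112 <| B 167
 (U 21731 <| U 42481 <| L 19807833991611864022690844328)
 (U 21745 <| L 69325586687185082833437763008))
 (U 21668 <| U 21681 <| U 42490 <| L 3894282065967494199894859396942332)))
 (B 103
 (U 21733 <| U 21744 <| U 26084 <| U 26097 <| U 26339 <| U 42481 <| B 95
 (U 21477 <| U 24036 <| U 24049 <| U 40433 <| L 1298074215143730269688246140203236)
 (U 23781 <| U 23792 <| L 3894227595793506070006733295614796))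
 (B 95
 (U 21477 <| U 23780 <| U 24036 <| U 24291 <| U 40177 <| U 40433 <| U 59120 <| U 61168 <| L 49518791611948287927967045512)
 (L 3894257306751133972783677328853712)))))))))
 (B 158
 (U 40684 <| B 238
 (U 40387 <| U 44780 <| B 102
 (B 166
 (U 42732 <| B 94
 (U 24003 <| B 303
 (U 77553 <| B 87
 (U 22257 <| B 103
 (U 26083 <| B 95
 (L 3894222644694484415661485083120296)
 (U 21476 <| U 23781 <| U 23792 <| U 24037 <| U 24048 <| U 40176 <| U 40432 <| L 2596148429664105281243227625664852))
 (U 21732 <| U 21745 <| U 26096 <| U 26338 <| U 42480 <| B 230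
 (B 95
 (U 23780 <| U 23793 <| B 111
 (L 1298079166582761950575088888755584)
 (U 21988 <| U 22001 <| U 24036 <| U 24049 <| L 3894252354632071574179783115849616))
 (U 21476 <| U 21489 <| B 175
 (U 21987 <| U 24037 <| U 24048 <| U 40432 <| L 49518130484675952678817286676)
 (U 22001 <| L 1298123732235296697164791862556672)))
 (U 23753 <| U 40137 <| U 58832 <| L 2596178139828364445732949681307428)))
 (U 22242 <| B 111
 (U 21989 <| U 22000 <| B 167
 (B 159
 (L 1298084118361808558291545795630512)
 (U 21474 <| U 24037 <| U 24048 <| U 40165 <| U 40432 <| U 59121 <| L 1298118781155142170708304098033444))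
 (U 21730 <| U 26096 <| U 42480 <| B 159
 (U 21488 <| U 40164 <| U 58864 <| L 2596212802395037653641137660905192)
 (U 21474 <| U 24037 <| U 24048 <| U 40432 <| L 2596222706293133040748837451358048)))
 (U 26080 <| B 95
 (U 21477 <| U 21488 <| U 23780 <| U 23793 <| U 24036 <| U 24049 <| U 40177 <| U 40433 <| L 34663114472908054923588935328)
 (L 3894222644694484415661485083120296))))
 (B 85
 (U 21971 <| B 111
 (U 22011 <| U 26081 <| U 26089 <| B 93
 (L 3894277114093998533487016116508128)
 (U 21412 <| U 23717 <| U 23728 <| U 23789 <| U 24045 <| U 40112 <| L 49517998265764457553644798100))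
 (U 21996 <| U 28386 <| B 93
 (U 24044 <| B 101
 (L 3894252354632071574179783115849616)
 (U 21668 <| U 23716 <| U 26098 <| U 42482 <| U 58866 <| L 1298074215427075213047070436946516))
 (U 21412 <| U 24058 <| U 40442 <| B 231
 (U 23792 <| U 40176 <| U 58865 <| L 2596202899233616521883340227222656)
 (U 23778 <| U 40162 <| L 3894222644297811755960743200076116))))
 (B 175
 (U 42465 <| U 42473 <| U 21680 <| B 159
 (L 1298084118361808558291545795630512)
 (U 40165 <| U 40176 <| U 40421 <| U 40432 <| U 58857 <| U 21378 <| U 21410 <| B 83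
 (U 21459 <| L 2596148429664105281243227625664852)
 (U 21482 <| U 21490 <| U 22242 <| L 1298118781155142170708304098033444)))
 (U 21994 <| U 22002 <| U 22242 <| B 159
 (U 21488 <| U 40420 <| U 40433 <| B 167
 (U 21744 <| U 42481 <| L 1298074215823755510646345244382192)
 (U 21730 <| U 40164 <| B 84
 (U 21715 <| L 1298074215427075213047070436946516)
 (L 3894247402701909455480869887194280)))
 (U 21474 <| B 103
 (U 23781 <| U 23792 <| U 26097 <| U 40176 <| B 83
 (U 21428 <| U 21436 <| U 21459 <| L 2596202899233616521883340227222656)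
 (L 29711750985039644740072524792))
 (L 3894222644694484415661485083120296))))))
 (U 21440 <| U 21448 <| U 21968 <| U 22250 <| U 22258 <| U 23749 <| U 23760 <| U 24016 <| U 24306 <| B 157
 (L 34662850012170522719268422556)
 (B 229
 (U 40112 <| L 2596158332882179534259524456171992)
 (U 23714 <| U 26077 <| U 40098 <| B 239
 (U 58861 <| B 231
 (L 1298118781155142170708304098033444)
 (U 23778 <| L 2596222706293133040748837451358048))
 (U 24034 <| U 26106 <| U 40426 <| L 3894287017708761659296027467885264)))))
 (U 21697 <| U 21705 <| U 21955 <| U 40132 <| U 40145 <| U 42437 <| U 42448 <| U 42746 <| U 58832 <| U 59130 <| U 21379 <| U 21443 <| B 101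
 (U 23713 <| B 303
 (U 26091 <| U 26099 <| U 21729 <| U 23777 <| L 2596148430457456220955075428783100)
 (U 77538 <| L 3894237499313824676680768881176148))
 (L 2596178139828364445732949681307428)))
 (B 86
 (U 21443 <| U 21700 <| U 21713 <| U 21955 <| U 23748 <| U 23761 <| U 26053 <| U 26064 <| U 40145 <| U 42448 <| U 42746 <| U 58832 <| U 59130 <| L 2596178139828364445732949681307428)
 (U 21456 <| U 21968 <| U 22250 <| U 22258 <| U 26362 <| B 230
 (U 23744 <| U 23752 <| U 23802 <| U 24016 <| U 40131 <| U 42732 <| U 21402 <| B 157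
 (L 34662850012170522719268422556)
 (B 229
 (U 40112 <| L 2596158332882179534259524456171992)
 (U 23714 <| U 40098 <| U 42445 <| B 175
 (L 2596222706293133040748837451358048)
 (U 40442 <| U 42490 <| L 4951873495882765069944138516))))
 (U 40145 <| U 58821 <| U 58832 <| U 59130 <| U 26064 <| B 303
 (B 165
 (U 21672 <| U 42475 <| U 42483 <| U 40161 <| L 1298113829281662861190140745755588)
 (L 3894222644958936866658884166672732))
 (U 58850 <| U 77538 <| B 167
 (U 42481 <| L 3894222644958936866658884166672732)
 (U 42466 <| B 157
 (L 3894272162163838864762516966239564)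
 (U 21410 <| U 24050 <| U 40098 <| L 3894287017708761659296027467885264)))))))
 (U 40401 <| U 61178 <| B 87
 (U 22257 <| U 21443 <| U 24017 <| B 166
 (U 21699 <| U 42732 <| B 175
 (U 21987 <| U 24033 <| U 40417 <| U 44772 <| U 44785 <| U 21955 <| B 103
 (L 3894277114093998533487016116508128)
 (U 21732 <| U 21745 <| U 23780 <| U 23793 <| U 26085 <| U 26096 <| U 26338 <| U 40177 <| U 42480 <| U 58856 <| U 77553 <| U 58816 <| L 2596178139828364445732949681307428))
 (U 22001 <| B 302
 (U 42435 <| U 58816 <| U 58824 <| U 58874 <| U 23729 <| U 40113 <| B 167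
 (U 42468 <| U 42481 <| U 21667 <| L 3894252354632071574179783115849616)
 (U 21745 <| L 1298074215427079464469034387427968))
 (U 26065 <| U 42449 <| U 42476 <| L 49517941587206371381767896964)))
 (U 21713 <| U 40132 <| U 40145 <| U 42746 <| U 59130 <| U 21379 <| B 175
 (U 21987 <| U 24033 <| U 42469 <| U 42480 <| U 44772 <| U 44785 <| U 58856 <| U 77553 <| U 21955 <| B 101
 (U 26067 <| L 2596148430457456220955075428783100)
 (L 2596178139828364445732949681307428))
 (U 22001 <| L 1298074215427079464469034387427968)))
 (U 22242 <| B 230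
 (U 40131 <| U 42732 <| U 58820 <| U 58833 <| U 58860 <| U 40099 <| B 93
 (U 23715 <| B 111
 (U 21989 <| U 22000 <| U 24033 <| U 24305 <| U 26081 <| U 26353 <| U 28388 <| U 28401 <| U 44785 <| L 1298084118361808558291545795630512)
 (L 3894247403325268532705652086161248))
 (U 21416 <| U 23728 <| U 24010 <| U 24018 <| U 24042 <| U 24050 <| L 24759726383445642326815328652))
 (U 40145 <| U 59130 <| B 94
 (U 23761 <| U 24017 <| B 103
 (U 21733 <| U 26340 <| U 26353 <| U 42737 <| B 175
 (U 22000 <| U 44772 <| U 44785 <| B 111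
 (U 28401 <| L 1298084118361808558291545795630512)
 (U 26084 <| U 26097 <| U 42473 <| L 2596178140886182968514958328911232))
 (U 21986 <| U 26084 <| U 26097 <| U 42481 <| B 302
 (U 26051 <| U 58824 <| L 2596148429852995905145554126037200)
 (L 3894247403325268532705652086161248)))
 (B 111
 (U 21989 <| U 22000 <| U 24033 <| U 26085 <| U 26096 <| U 28388 <| U 28401 <| U 44785 <| U 58856 <| U 77553 <| U 21424 <| B 165
 (U 21672 <| U 42451 <| B 102
 (L 1298084118361808558291545795630512)
 (U 21696 <| L 1298113829281662861190140745755588))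
 (L 3894222644958936866658884166672732))
 (L 2596173188068216023340435107800064)))
 (U 23746 <| U 24002 <| U 26362 <| U 28410 <| L 2596222705669778575280720254626816)))))
 (U 40698 <| B 86
 (U 21457 <| B 174
 (U 21955 <| U 40389 <| U 40400 <| U 44780 <| B 102
 (B 95
 (U 21473 <| B 111
 (B 103
 (B 230
 (U 40144 <| L 2596222706066459665591321714789716)
 (U 23745 <| U 23753 <| U 40130 <| U 42437 <| U 42448 <| U 42746 <| U 58832 <| U 21403 <| B 311
 (L 39614704621541674229805678372)
 (U 59122 <| L 3894237499389382324230602571656532)))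
 (U 21732 <| U 23780 <| U 23793 <| U 26085 <| U 26096 <| U 26356 <| U 26364 <| U 42480 <| U 58864 <| U 59106 <| U 23771 <| L 2596183092230761050906344841862716))
 (U 21988 <| U 22001 <| U 24036 <| U 24049 <| U 28386 <| U 24019 <| U 26348 <| B 165
 (U 21667 <| U 40101 <| B 167
 (U 21731 <| L 3894277113829540461948903145620456)
 (L 2596168237233640478403142488201756))
 (U 21681 <| U 42445 <| U 42490 <| L 1298089070556425145554041737064020)))
 (B 239
 (U 24048 <| B 231
 (U 23792 <| U 40176 <| U 23757 <| L 2596148429664105281243227625664852)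
 (U 23778 <| U 26364 <| U 40162 <| U 58853 <| U 58864 <| U 23714 <| U 40098 <| B 230
 (L 2596173188332652693708519652767016)
 (U 23745 <| U 40130 <| L 24759046352295723198869202432)))
 (U 24034 <| U 28386 <| U 40418 <| U 26348 <| B 229
 (U 40112 <| U 58843 <| B 92
 (U 23731 <| L 2596148429664105281243227625664852)
 (L 2596202899233616521883340227222656))
 (U 40098 <| U 42445 <| U 58874 <| U 23778 <| B 85
 (U 21681 <| L 1298089070556425145554041737064020)
 (U 21410 <| U 21666 <| U 22002 <| L 3894287017708761659296027467885264)))))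
 (U 21700 <| U 21713 <| U 26053 <| U 26064 <| U 42448 <| U 42746 <| B 95
 (U 21473 <| B 119
 (U 26349 <| U 28385 <| U 77537 <| B 92
 (U 23724 <| U 23756 <| L 1298074215313740002795361238291200)
 (U 23738 <| U 23770 <| U 23805 <| U 24301 <| L 1298148491206072033766884157431656))
 (U 24292 <| U 24305 <| U 26362 <| U 23748 <| U 23780 <| U 58832 <| B 111
 (U 26085 <| L 3894252355482094875043133975992332)
 (U 21988 <| U 22001 <| L 2596153381669827713451704049481464)))
 (B 119
 (U 24293 <| U 24304 <| U 26349 <| U 28385 <| U 24016 <| L 1298148491206072033766884157431656)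
 (U 26362 <| B 93
 (U 21409 <| U 24019 <| U 24052 <| U 24060 <| U 24300 <| U 40418 <| L 2596153381669827713451704049481464)
 (L 9903633653024467036392168192)))))
 (U 21969 <| U 44794 <| B 166
 (U 21699 <| U 40133 <| U 40144 <| U 42436 <| U 42449 <| U 42476 <| U 42732 <| U 58833 <| U 21667 <| B 95
 (B 247
 (U 24291 <| B 238
 (U 61179 <| L 49518527161443019843218491988)
 (U 61165 <| B 94
 (U 24017 <| L 3894252354820969043818251954469488)
 (U 23760 <| U 24002 <| L 19807833991611864022690844328)))
 (U 24305 <| B 239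
 (U 24035 <| U 61156 <| U 61169 <| U 24003 <| L 39614704621541674229805678372)
 (U 24049 <| L 3894247403533056549068317361440200)))
 (B 119
 (U 24293 <| U 24304 <| U 26337 <| U 23760 <| B 110
 (U 24005 <| U 24016 <| U 28411 <| U 40392 <| L 2596148429664105281243227625664852)
 (L 19807833991611864022690844328))
 (B 111
 (U 24037 <| U 24048 <| U 26081 <| U 28388 <| U 28401 <| U 40424 <| U 61169 <| U 23728 <| L 2596148429664105281243227625664852)
 (L 24759650823852462961501195668))))
 (U 21713 <| U 42746 <| B 95
 (B 247
 (U 24291 <| B 111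
 (B 103
 (L 49517998268574681180162541908)
 (U 23780 <| U 26085 <| U 26096 <| U 26341 <| U 26352 <| U 42472 <| U 58864 <| U 59120 <| B 302
 (L 49517714926513448544669555696)
 (U 26050 <| L 2596173188748238526126451669862392)))
 (U 24036 <| U 24049 <| U 28389 <| U 28400 <| U 61168 <| B 103
 (U 26084 <| U 26097 <| L 3894287017708761659296027467885264)
 (U 23780 <| U 23793 <| U 26341 <| U 26352 <| U 59120 <| L 74277195718078686471486722772)))
 (U 24305 <| B 239
 (U 24035 <| U 40424 <| U 61156 <| U 61169 <| U 24003 <| B 230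
 (U 23747 <| U 40136 <| U 59116 <| B 103
 (L 9903690322286855293803495204)
 (U 23780 <| U 23793 <| U 26085 <| U 26096 <| U 26338 <| U 42472 <| U 58864 <| L 2596178139828364445732949681307428))
 (U 23761 <| U 58821 <| U 58832 <| U 40098 <| L 34662698897956461509961876348))
 (U 24049 <| B 231
 (U 23779 <| U 40168 <| U 58852 <| U 58865 <| U 59108 <| U 59121 <| U 23715 <| U 23747 <| B 165
 (U 42444 <| L 3894247403533056549068317361440200)
 (U 40096 <| L 1298103926271351908610504641232744))
 (U 23793 <| L 1298148491036074766706279523064832))))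
 (B 119
 (U 24293 <| U 24304 <| B 231
 (U 23792 <| U 40168 <| B 239
 (U 24048 <| U 40424 <| L 1298148491036074766706279523064832)
 (U 24034 <| U 28389 <| U 28400 <| U 58852 <| U 58865 <| U 61168 <| B 101
 (L 1298074215162630255968256289450692)
 (U 21668 <| U 23712 <| L 3894282065967494199894859396942332)))
 (U 23778 <| U 26341 <| U 26352 <| U 59120 <| B 239
 (U 24048 <| U 40424 <| U 58853 <| U 58864 <| U 23714 <| U 40098 <| L 4952950199908360631419447920)
 (U 24034 <| U 28389 <| U 28400 <| U 61168 <| L 2596173188068209465976780414317756)))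
 (B 103
 (U 23781 <| U 23792 <| U 26340 <| U 26353 <| U 40168 <| U 59121 <| B 111
 (U 24037 <| U 24048 <| U 28388 <| U 28401 <| U 40424 <| L 2596148430457460544411267513734136)
 (U 26084 <| U 26097 <| U 58865 <| B 302
 (U 26051 <| U 42440 <| U 58819 <| U 40096 <| L 2596202899233616521883340227222656)
 (L 1298123732556417473972701894805976)))
 (B 111
 (U 24037 <| U 24048 <| U 26085 <| U 26096 <| U 28388 <| U 28401 <| U 40424 <| U 42472 <| L 9903633653024467036392168192)
 (L 49517998268574681180162541908)))))))
 (U 21442 <| U 22250 <| U 22258 <| U 24314 <| B 174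
 (U 21968 <| U 40389 <| U 40400 <| U 44780 <| U 21410 <| B 229
 (U 23728 <| U 40112 <| U 58843 <| B 166
 (U 21712 <| U 42732 <| L 3894257306524458796369926849309852)
 (U 21698 <| U 42437 <| U 42448 <| U 42746 <| U 21666 <| B 303
 (U 58859 <| L 2596222706293133040748837451358048)
 (U 42466 <| L 3894287017708761659296027467885264)))
 (U 23714 <| U 40098 <| U 42445 <| B 239
 (U 58861 <| B 103
 (U 21733 <| U 23781 <| U 23792 <| U 26083 <| U 26340 <| U 28401 <| U 40176 <| U 42467 <| U 59121 <| L 24759688593272551432812292032)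
 (L 2596222706293133040748837451358048))
 (U 24034 <| U 26106 <| U 40418 <| L 3894287017708761659296027467885264)))
 (U 21954 <| U 28410 <| U 44794 <| B 166
 (U 40133 <| U 42436 <| U 42449 <| U 42476 <| U 42732 <| U 58833 <| L 3894272161767144803833751668807224)
 (U 21698 <| U 26362 <| U 42746 <| L 3894222644297811755960743200076116)))))

theorem cert_ok : check cert K0 = true := by decide +kernel

/-- meaning of a literal -/
def lit (O : ℕ → Bool) (i : ℕ) : Prop := O (i / 2) = Nat.beq (i % 2) 1

def Holds (O : ℕ → Bool) (K : ℕ) : Prop := ∀ i, tb K i = true → lit O i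

theorem lit_pl {O : ℕ → Bool} {t : ℕ} : lit O (pl t) ↔ O t = true := by
  have h1 : pl t / 2 = t := by show (2 * t + 1) / 2 = t; omega
  have h2 : pl t % 2 = 1 := by show (2 * t + 1) % 2 = 1; omega
  simp [lit, h1, h2]

theorem lit_nl {O : ℕ → Bool} {t : ℕ} : lit O (nl t) ↔ O t = false := by
  have h1 : nl t / 2 = t := by show (2 * t) / 2 = t; omega
  have h2 : nl t % 2 = 0 := by show (2 * t) % 2 = 0; omega
  have h3 : Nat.beq 0 1 = false := rfl
  simp [lit, h1, h2, h3]

theorem lt_zero (t : ℕ) : lt t 0 = nl t := rfl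
theorem lt_one (t : ℕ) : lt t 1 = pl t := rfl

theorem Holds.ins {O : ℕ → Bool} {K i : ℕ} (h : Holds O K) (hi : lit O i) :
    Holds O (ins K i) := by
  intro j hj
  rcases (tb_ins K i j).1 hj with hj | rfl
  · exact h j hj
  · exact hi

/-- the signotope axioms -/
def Axm (O : ℕ → Bool) : Prop := ∀ om w x y z : ℕ, w < x → x < y → y < z → z < 8 →
  ¬ (O (tri om w x y z).1 = O (tri om w x y z).2.2 ∧
      O (tri om w x y z).2.1 ≠ O (tri om w x y z).1)

/-- A colouring without crossings whose four colour classes are connected. -/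
def Good (O : ℕ → Bool) (col : ℕ) : Prop :=
  (∀ k < 4, conn col k 7 1 = true) ∧
  ∀ w x y z : ℕ, w < x → x < y → y < z → z < 8 →
    (colr col w y = colr col x z →
      ¬ (O (tc w x y) = O (tc w y z) ∧ O (tc w x z) = O (tc x y z))) ∧
    (colr col w z = colr col x y →
      ¬ (O (tc w x z) ≠ O (tc w y z) ∧ O (tc w x y) ≠ O (tc x y z)))

theorem mem_quads_fin : ∀ w x y z : Fin 8, w < x → x < y → y < z →
    (w.val, x.val, y.val, z.val) ∈ quads := by decide +kernel

theorem mem_quads (w : ℕ) (hw : w < 8) (x : ℕ) (hx : x < 8) (y : ℕ) (hy : y < 8) (z : ℕ)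
    (hz : z < 8) (h1 : w < x) (h2 : x < y) (h3 : y < z) : (w, x, y, z) ∈ quads :=
  mem_quads_fin ⟨w, hw⟩ ⟨x, hx⟩ ⟨y, hy⟩ ⟨z, hz⟩ h1 h2 h3

theorem unit_sound {O : ℕ → Bool} {K i j k f s : ℕ} (hs : s < 2) (hK : Holds O K)
    (hax : ¬ (O i = O k ∧ O j ≠ O i)) (h : (unitOK K i j k f s).1 = true) :
    lit O (unitOK K i j k f s).2 := by
  have hp : ∀ t, tb K (pl t) = true → O t = true := fun t ht => lit_pl.1 (hK _ ht)
  have hn : ∀ t, tb K (nl t) = true → O t = false := fun t ht => lit_nl.1 (hK _ ht)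
  unfold unitOK at h ⊢
  split at h <;> interval_cases s <;>
    simp only [Nat.sub_zero, Nat.sub_self, lt_zero, lt_one, Bool.and_eq_true] at h ⊢ <;>
    simp only [lit_pl, lit_nl] <;> obtain ⟨h1, h2⟩ := h
  · have := hn _ h1; have := hp _ h2; revert hax; simp_all
  · have := hp _ h1; have := hn _ h2; revert hax; simp_all
  · have := hn _ h1; have := hn _ h2; revert hax; simp_all
  · have := hp _ h1; have := hp _ h2; revert hax; simp_all
  · have := hp _ h1; have := hn _ h2; revert hax; simp_all
  · have := hn _ h1; have := hp _ h2; revert hax; simp_all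

theorem quad_sound {O : ℕ → Bool} (hax : Axm O) {K col w x y z : ℕ} (hK : Holds O K)
    (h1 : w < x) (h2 : x < y) (h3 : y < z) (h4 : z < 8) (h : quadOK K col w x y z = true) :
    (colr col w y = colr col x z →
      ¬ (O (tc w x y) = O (tc w y z) ∧ O (tc w x z) = O (tc x y z))) ∧
    (colr col w z = colr col x y →
      ¬ (O (tc w x z) ≠ O (tc w y z) ∧ O (tc w x y) ≠ O (tc x y z))) := by
  have hp : ∀ t, tb K (pl t) = true → O t = true := fun t ht => lit_pl.1 (hK _ ht)
  have hn : ∀ t, tb K (nl t) = true → O t = false := fun t ht => lit_nl.1 (hK _ ht)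
  have a0 := hax 0 w x y z h1 h2 h3 h4
  have a1 := hax 1 w x y z h1 h2 h3 h4
  have a2 := hax 2 w x y z h1 h2 h3 h4
  have a3 := hax 3 w x y z h1 h2 h3 h4
  simp only [tri] at a0 a1 a2 a3
  unfold quadOK at h
  rw [Bool.and_eq_true] at h
  obtain ⟨hA, hB⟩ := h
  have p1 := hp (tc w x y)
  have p2 := hp (tc w x z)
  have p3 := hp (tc w y z)
  have p4 := hp (tc x y z)
  have n1 := hn (tc w x y)
  have n2 := hn (tc w x z)
  have n3 := hn (tc w y z)
  have n4 := hn (tc x y z)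
  clear hp hn
  constructor
  · intro hc
    have : Nat.beq (colr col w y) (colr col x z) = true := Nat.beq_eq ▸ hc
    simp only [this, Bool.not_true, Bool.false_or, Bool.and_eq_true, Bool.or_eq_true] at hA
    cases e1 : O (tc w x y) <;> cases e2 : O (tc w x z) <;> cases e3 : O (tc w y z) <;>
      cases e4 : O (tc x y z) <;> simp_all
  · intro hc
    have : Nat.beq (colr col w z) (colr col x y) = true := Nat.beq_eq ▸ hc
    simp only [this, Bool.not_true, Bool.false_or, Bool.and_eq_true, Bool.or_eq_true] at hB
    cases e1 : O (tc w x y) <;> cases e2 : O (tc w x z) <;> cases e3 : O (tc w y z) <;>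
      cases e4 : O (tc x y z) <;> simp_all

theorem leaf_sound {O : ℕ → Bool} (hax : Axm O) {K col : ℕ} (hK : Holds O K)
    (h : leafOK K col = true) : Good O col := by
  unfold leafOK at h
  simp only [Bool.and_eq_true, List.all_eq_true] at h
  obtain ⟨⟨⟨⟨c0, c1⟩, c2⟩, c3⟩, hq⟩ := h
  refine ⟨?_, ?_⟩
  · intro k hk
    interval_cases k <;> assumption
  · intro w x y z h1 h2 h3 h4
    exact quad_sound hax hK h1 h2 h3 h4
      (hq _ (mem_quads w (by omega) x (by omega) y (by omega) z h4 h1 h2 h3))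

theorem check_sound {O : ℕ → Bool} (hax : Axm O) : ∀ (t : Tr) (K : ℕ), Holds O K →
    check t K = true → ∃ col, Good O col
  | L c, K, hK, h => ⟨c, leaf_sound hax hK h⟩
  | B t a b, K, hK, h => by
    simp only [check, Bool.and_eq_true] at h
    cases e : O t
    · exact check_sound hax b _ (hK.ins (lit_nl.2 e)) h.2
    · exact check_sound hax a _ (hK.ins (lit_pl.2 e)) h.1
  | U n t, K, hK, h => by
    simp only [check, Bool.and_eq_true] at h
    obtain ⟨⟨⟨⟨h1, h2⟩, h3⟩, h4⟩, h5⟩ := h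
    have b1 := cast Nat.blt_eq h1
    have b2 := cast Nat.blt_eq h2
    have b3 := cast Nat.blt_eq h3
    exact check_sound hax t _ (hK.ins (unit_sound (by omega) hK
      (hax _ _ _ _ _ b1 b2 b3 (by omega)) h4)) h5

theorem comb_main {O : ℕ → Bool} (hax : Axm O)
    (h0 : ∀ b c, 0 < b → b < c → c < 8 → O (tc 0 b c) = true) : ∃ col, Good O col := by
  refine check_sound hax cert K0 ?_ cert_ok
  have key : ∀ (l : List (ℕ × ℕ)) (K : ℕ), Holds O K →
      (∀ e ∈ l, O (tc 0 e.1 e.2) = true) →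
      Holds O (l.foldl (fun K e => ins K (pl (tc 0 e.1 e.2))) K) := by
    intro l
    induction l with
    | nil => intro K hK _; exact hK
    | cons e l ih =>
      intro K hK he
      rw [List.foldl_cons]
      exact ih _ (hK.ins (lit_pl.2 (he e (by simp)))) fun e' he' => he e' (by simp [he'])
  refine key _ 0 ?_ ?_
  · intro i hi
    rw [tb_eq] at hi
    simp at hi
  · intro e he
    have : ∀ e ∈ edges.filter (fun e => Nat.blt 0 e.1), 0 < e.1 ∧ e.1 < e.2 ∧ e.2 < 8 := by
      decide +kernel
    obtain ⟨h1, h2, h3⟩ := this e he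
    exact h0 _ _ h1 h2 h3

theorem edges_lt : ∀ e ∈ edges, e.1 < e.2 ∧ e.2 < 8 := by decide +kernel

theorem grow_sound {col k : ℕ} {Q : ℕ → Prop} : ∀ (l : List (ℕ × ℕ)) (R : ℕ),
    (∀ e ∈ l, colr col e.1 e.2 = k → (Q e.1 ↔ Q e.2)) →
    (∀ i, tb R i = true → Q i) → ∀ i, tb (grow col k l R) i = true → Q i
  | [], R, _, hR => hR
  | (u, v) :: l, R, hl, hR => by
    have hl' : ∀ e ∈ l, colr col e.1 e.2 = k → (Q e.1 ↔ Q e.2) :=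
      fun e he => hl e (List.mem_cons_of_mem _ he)
    rw [grow]
    cases hc : (Nat.beq (colr col u v) k && (tb R u || tb R v))
    · exact grow_sound l R hl' hR
    · rw [Bool.and_eq_true, Bool.or_eq_true] at hc
      have hk : colr col u v = k := Nat.eq_of_beq_eq_true hc.1
      have huv := hl (u, v) (by simp) hk
      simp only at huv
      have hu : Q u := by
        rcases hc.2 with h | h
        · exact hR _ h
        · exact huv.2 (hR _ h)
      refine grow_sound l _ hl' ?_
      intro i hi
      rcases (tb_ins _ _ _).1 hi with hi | rfl
      · rcases (tb_ins _ _ _).1 hi with hi | rfl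
        · exact hR _ hi
        · exact hu
      · exact huv.1 hu

theorem conn_sound {col k : ℕ} {Q : ℕ → Prop}
    (hQ : ∀ u v, u < v → v < 8 → colr col u v = k → (Q u ↔ Q v)) : ∀ (n R : ℕ),
    (∀ i, tb R i = true → Q i) → conn col k n R = true → ∀ i < 8, Q i := by
  have fin : ∀ R, (∀ i, tb R i = true → Q i) → Nat.beq R 255 = true → ∀ i < 8, Q i := by
    intro R hR h i hi
    have := Nat.eq_of_beq_eq_true h
    subst this
    apply hR
    interval_cases i <;> rfl
  intro n
  induction n with
  | zero => intro R hR h; exact fin R hR h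
  | succ n ih =>
    intro R hR h
    rw [conn, Bool.or_eq_true] at h
    rcases h with h | h
    · exact fin R hR h
    · exact ih _ (grow_sound edges R
        (fun e he => hQ _ _ (edges_lt e he).1 (edges_lt e he).2) hR) h

/-- orientation determinant -/
def D (p q r : Pt) : ℝ := (q.1 - p.1) * (r.2 - p.2) - (q.2 - p.2) * (r.1 - p.1)

theorem D_swap (p q r : Pt) : D q p r = - D p q r := by unfold D; ring
theorem D_rot (p q r : Pt) : D q r p = D p q r := by unfold D; ring
theorem D_swap' (p q r : Pt) : D p r q = - D p q r := by unfold D; ring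

theorem collinear_of_D {p q r : Pt} (hpq : p ≠ q) (h : D p q r = 0) :
    Collinear ℝ ({p, q, r} : Set Pt) := by
  rw [collinear_iff_of_mem (p₀ := p) (by simp)]
  refine ⟨q - p, ?_⟩
  unfold D at h
  intro x hx
  simp only [Set.mem_insert_iff, Set.mem_singleton_iff] at hx
  rcases hx with rfl | rfl | rfl
  · exact ⟨0, by simp⟩
  · exact ⟨1, by simp⟩
  · by_cases h1 : q.1 - p.1 = 0
    · have h2 : q.2 - p.2 ≠ 0 := by
        intro h2
        exact hpq (Prod.ext (by linarith) (by linarith))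
      refine ⟨(x.2 - p.2) / (q.2 - p.2), Prod.ext ?_ ?_⟩
      · have : x.1 - p.1 = 0 := by
          rw [h1] at h
          have : (q.2 - p.2) * (x.1 - p.1) = 0 := by linarith
          exact (mul_eq_zero.1 this).resolve_left h2
        simp [h1]; linarith
      · simp; field_simp; ring
    · refine ⟨(x.1 - p.1) / (q.1 - p.1), Prod.ext ?_ ?_⟩
      · simp; field_simp; ring
      · simp; field_simp; linarith

/-- Intersection of open segments forces a linear relation between orientations. -/
theorem inter_rel {a b c d z : Pt} (h1 : z ∈ openSegment ℝ a b) (h2 : z ∈ openSegment ℝ c d) :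
    ∃ s t : ℝ, 0 < s ∧ 0 < t ∧ s * D a b c + t * D a b d = 0 := by
  obtain ⟨u, v, hu, hv, huv, rfl⟩ := h1
  obtain ⟨s, t, hs, ht, hst, h⟩ := h2
  refine ⟨s, t, hs, ht, ?_⟩
  have e1 := congrArg Prod.fst h
  have e2 := congrArg Prod.snd h
  simp at e1 e2
  have hv' : v = 1 - u := by linarith
  have ht' : t = 1 - s := by linarith
  subst hv' ht'
  unfold D
  linear_combination (b.1 - a.1) * e2 - (b.2 - a.2) * e1

theorem opp_of_rel {s t x y : ℝ} (hs : 0 < s) (ht : 0 < t) (h : s * x + t * y = 0) (hx : x ≠ 0) :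
    x * y < 0 := by
  have hy : y = - (s / t) * x := by field_simp; linarith
  rw [hy]
  have : 0 < s / t := div_pos hs ht
  have h2 : 0 < x * x := mul_self_pos.2 hx
  nlinarith [mul_pos this h2]

/-- combinatorial crossing -/
def X (a b c d : Pt) : Prop := D a b c * D a b d < 0 ∧ D c d a * D c d b < 0

theorem X_swap1 {a b c d : Pt} (h : X a b c d) : X b a c d := by
  obtain ⟨h1, h2⟩ := h
  refine ⟨?_, by linarith [mul_comm (D c d a) (D c d b)]⟩
  rw [D_swap a b c, D_swap a b d]; linarith

theorem X_symm {a b c d : Pt} (h : X a b c d) : X c d a b := ⟨h.2, h.1⟩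

theorem X_swap2 {a b c d : Pt} (h : X a b c d) : X a b d c := X_symm (X_swap1 (X_symm h))

/-- the signotope axioms, seen from a point `o` around which `w, x, y, z` are sorted -/
theorem gp (o w x y z : Pt) :
    D o w y * D w x z = D o w x * D w y z + D o w z * D w x y ∧
    D o x y * D w x z = D o w x * D x y z + D o x z * D w x y ∧
    D o x y * D w y z = D o w y * D x y z + D o y z * D w x y ∧
    D o x z * D w y z = D o w z * D x y z + D o y z * D w x z := by
  unfold D
  refine ⟨?_, ?_, ?_, ?_⟩ <;> ring

theorem sgn_ax {a b c A B C : ℝ} (ha : 0 < a) (hb : 0 < b) (hc : 0 < c) (hA : A ≠ 0) (hB : B ≠ 0)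
    (hC : C ≠ 0) (h : b * B = a * C + c * A) :
    ¬ (decide (0 < A) = decide (0 < C) ∧ decide (0 < B) ≠ decide (0 < A)) := by
  rintro ⟨h1, h2⟩
  simp only [ne_eq, decide_eq_decide] at h1 h2
  rcases lt_or_gt_of_ne hA with hA | hA
  · have hC' : C < 0 := lt_of_le_of_ne (not_lt.1 fun h => absurd (h1.2 h) (by linarith)) hC
    have hB' : 0 < B := by
      by_contra hn
      exact h2 ⟨fun h => absurd h hn, fun h => absurd h (by linarith)⟩
    nlinarith [mul_pos hb hB', mul_pos ha (neg_pos.2 hC'), mul_pos hc (neg_pos.2 hA)]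
  · have hC' : 0 < C := h1.1 hA
    have hB' : B < 0 := by
      refine lt_of_le_of_ne (not_lt.1 fun h => h2 ⟨fun _ => hA, fun _ => h⟩) hB
    nlinarith [mul_pos hb (neg_pos.2 hB'), mul_pos ha hC', mul_pos hc hA]

theorem exists_sort {α : Type} [Fintype α] (f : α → EReal) (hf : Function.Injective f)
    (h : Fintype.card α = 8) : ∃ e : Fin 8 ≃ α, StrictMono (f ∘ e) := by
  let _ : LinearOrder α := LinearOrder.lift' f hf
  let e : Fin 8 ≃o α := Fintype.orderIsoFinOfCardEq _ h
  exact ⟨e.toEquiv, fun i j hij => e.strictMono hij⟩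

open Classical in
theorem label (S : Finset Pt) (hS : S.card = 8)
    (hD : ∀ p ∈ S, ∀ q ∈ S, ∀ r ∈ S, p ≠ q → p ≠ r → q ≠ r → D p q r ≠ 0) :
    ∃ e : Fin 8 ≃ {x // x ∈ S}, ∀ j k : Fin 8, 0 < j → j < k →
      0 < D (e 0 : Pt) (e j : Pt) (e k : Pt) := by
  have hne : S.Nonempty := Finset.card_pos.1 (by omega)
  obtain ⟨o, hoS, ho⟩ := S.exists_min_image (fun p => toLex p) hne
  have hlex : ∀ q ∈ S, q ≠ o → 0 < q.1 - o.1 ∨ (q.1 - o.1 = 0 ∧ 0 < q.2 - o.2) := by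
    intro q hq hqo
    have h := ho q hq
    rw [Prod.Lex.toLex_le_toLex] at h
    rcases h with h | ⟨h1, h2⟩
    · left; linarith
    · right
      refine ⟨by linarith, ?_⟩
      have : o.2 ≠ q.2 := fun h => hqo (Prod.ext h1.symm h.symm)
      have := lt_of_le_of_ne h2 this
      linarith
  let f : {x // x ∈ S} → EReal := fun q =>
    if q.1 = o then ⊥ else if q.1.1 - o.1 = 0 then ⊤
      else (((q.1.2 - o.2) / (q.1.1 - o.1) : ℝ) : EReal)
  have f0 : ∀ q, f q = ⊥ ↔ q.1 = o := by
    intro q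
    simp only [f]
    split_ifs with h1 h2 <;> simp [h1]
  have flt : ∀ q r, q.1 ≠ o → f q < f r → 0 < D o q.1 r.1 := by
    intro q r hq hqr
    have hr : r.1 ≠ o := by
      intro h
      rw [(f0 r).2 h] at hqr
      exact not_lt_bot hqr
    simp only [f, hq, hr, if_false] at hqr
    have lq := hlex q.1 q.2 hq
    have lr := hlex r.1 r.2 hr
    unfold D
    split_ifs at hqr with h1 h2 h2
    · exact absurd hqr (lt_irrefl _)
    · exact absurd hqr not_top_lt
    · have hq1 : 0 < q.1.1 - o.1 := lq.resolve_right fun h => h1 h.1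
      have hr2 : 0 < r.1.2 - o.2 := (lr.resolve_left (by linarith)).2
      rw [h2]
      nlinarith [mul_pos hq1 hr2]
    · have hq1 : 0 < q.1.1 - o.1 := lq.resolve_right fun h => h1 h.1
      have hr1 : 0 < r.1.1 - o.1 := lr.resolve_right fun h => h2 h.1
      rw [EReal.coe_lt_coe_iff, div_lt_div_iff₀ hq1 hr1] at hqr
      linarith
  have feq : ∀ q r, q.1 ≠ o → f q = f r → D o q.1 r.1 = 0 := by
    intro q r hq hqr
    have hr : r.1 ≠ o := by
      intro h
      rw [(f0 r).2 h] at hqr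
      exact hq ((f0 q).1 hqr)
    simp only [f, hq, hr, if_false] at hqr
    unfold D
    split_ifs at hqr with h1 h2 h2
    · rw [h1, h2]; ring
    · exact absurd hqr.symm (EReal.coe_ne_top _)
    · exact absurd hqr (EReal.coe_ne_top _)
    · rw [EReal.coe_eq_coe_iff, div_eq_div_iff h1 h2] at hqr
      linarith
  have finj : Function.Injective f := by
    intro q r hqr
    by_cases hq : q.1 = o
    · have := (f0 q).2 hq
      rw [hqr] at this
      exact Subtype.ext (hq.trans ((f0 r).1 this).symm)
    · by_contra hne
      have hr : r.1 ≠ o := by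
        intro h
        exact hq ((f0 q).1 (hqr.trans ((f0 r).2 h)))
      exact hD o hoS q.1 q.2 r.1 r.2 (Ne.symm hq) (Ne.symm hr) (fun h => hne (Subtype.ext h))
        (feq q r hq hqr)
  obtain ⟨e, hmono⟩ := exists_sort f finj (by simp [hS])
  refine ⟨e, ?_⟩
  have e0 : (e 0).1 = o := by
    rw [← f0]
    have h2 := hmono.monotone (Fin.zero_le (e.symm ⟨o, hoS⟩))
    simp only [Function.comp_apply, e.apply_symm_apply] at h2
    rw [(f0 ⟨o, hoS⟩).2 rfl] at h2
    exact le_bot_iff.1 h2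
  intro j k hj hjk
  show 0 < D (e 0).1 (e j).1 (e k).1
  rw [e0]
  refine flt _ _ ?_ (hmono hjk)
  intro h
  have : e j = e 0 := Subtype.ext (h.trans e0.symm)
  exact absurd (e.injective this) (by omega)

/-- the orientation function attached to eight labelled points -/
noncomputable def Or (p : ℕ → Pt) (t : ℕ) : Bool :=
  decide (0 < D (p (t / 64)) (p (t / 8 % 8)) (p (t % 8)))

theorem Or_tc (p : ℕ → Pt) {a b c : ℕ} (hb : b < 8) (hc : c < 8) :
    Or p (tc a b c) = decide (0 < D (p a) (p b) (p c)) := by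
  have h : tc a b c = 64 * a + (8 * b + c) := rfl
  have h1 : tc a b c / 64 = a := by omega
  have h2 : tc a b c / 8 % 8 = b := by omega
  have h3 : tc a b c % 8 = c := by omega
  rw [Or, h1, h2, h3]

theorem dec_ne {x y : ℝ} (h : x * y < 0) : decide (0 < x) ≠ decide (0 < y) := by
  intro he
  rw [decide_eq_decide] at he
  rcases mul_neg_iff.1 h with ⟨h1, h2⟩ | ⟨h1, h2⟩
  · have := he.1 h1; linarith
  · have := he.2 h2; linarith

theorem dec_eq {x y : ℝ} (h : 0 < x * y) : decide (0 < x) = decide (0 < y) := by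
  rw [decide_eq_decide]
  rcases mul_pos_iff.1 h with ⟨h1, h2⟩ | ⟨h1, h2⟩
  · exact ⟨fun _ => h2, fun _ => h1⟩
  · constructor <;> intro h <;> linarith

theorem axm_Or (p : ℕ → Pt)
    (hne : ∀ a b c, a < b → b < c → c < 8 → D (p a) (p b) (p c) ≠ 0)
    (hpos : ∀ b c, 0 < b → b < c → c < 8 → 0 < D (p 0) (p b) (p c)) : Axm (Or p) := by
  intro om w x y z h1 h2 h3 h4
  have t1 := Or_tc p (a := w) (b := x) (c := y) (by omega) (by omega)
  have t2 := Or_tc p (a := w) (b := x) (c := z) (by omega) (by omega)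
  have t3 := Or_tc p (a := w) (b := y) (c := z) (by omega) (by omega)
  have t4 := Or_tc p (a := x) (b := y) (c := z) (by omega) (by omega)
  rcases Nat.eq_zero_or_pos w with rfl | hw
  · have q1 := hpos x y (by omega) h2 (by omega)
    have q2 := hpos x z (by omega) (by omega) (by omega)
    have q3 := hpos y z (by omega) h3 (by omega)
    rw [decide_eq_true q1] at t1
    rw [decide_eq_true q2] at t2
    rw [decide_eq_true q3] at t3
    unfold tri
    split <;> simp [t1, t2, t3] 
  · have wx := hpos w x hw h1 (by omega)
    have wy := hpos w y hw (by omega) (by omega)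
    have wz := hpos w z hw (by omega) (by omega)
    have xy := hpos x y (by omega) h2 (by omega)
    have xz := hpos x z (by omega) (by omega) (by omega)
    have yz := hpos y z (by omega) h3 (by omega)
    have n1 := hne w x y h1 h2 (by omega)
    have n2 := hne w x z h1 (by omega) (by omega)
    have n3 := hne w y z (by omega) h3 (by omega)
    have n4 := hne x y z h2 h3 (by omega)
    obtain ⟨g3, g2, g1, g0⟩ := gp (p 0) (p w) (p x) (p y) (p z)
    unfold tri
    split
    · simp only [t2, t3, t4]; exact sgn_ax wz xz yz n2 n3 n4 g0
    · simp only [t1, t3, t4]; exact sgn_ax wy xy yz n1 n3 n4 g1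
    · simp only [t1, t2, t4]; exact sgn_ax wx xy xz n1 n2 n4 g2
    · simp only [t1, t2, t3]; exact sgn_ax wx wy wz n1 n2 n3 g3

/-- colour of an unordered edge -/
def cc (col u v : ℕ) : ℕ := colr col (min u v) (max u v)

theorem cc_comm (col u v : ℕ) : cc col u v = cc col v u := by
  rw [cc, cc, min_comm, max_comm]

theorem cc_lt {col u v : ℕ} (h : u < v) : cc col u v = colr col u v := by
  rw [cc, min_eq_left h.le, max_eq_right h.le]

/-- sorted case of the non-crossing property -/
theorem noX_sorted (p : ℕ → Pt) (hax : Axm (Or p)) {col : ℕ} (hg : Good (Or p) col) {a b c d : ℕ}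
    (hab : a < b) (hcd : c < d) (hac : a < c) (hb : b < 8) (hd : d < 8) (hbc : b ≠ c) (hbd : b ≠ d)
    (hcol : colr col a b = colr col c d) : ¬ X (p a) (p b) (p c) (p d) := by
  rintro ⟨h1, h2⟩
  rcases lt_or_gt_of_ne hbc with hbc | hbc
  · -- `a b c d`
    have e1 := dec_ne h1
    rw [D_rot (p a) (p c) (p d), D_rot (p b) (p c) (p d)] at h2
    have e2 := dec_ne h2
    rw [← Or_tc p (by omega) (by omega), ← Or_tc p (by omega) (by omega)] at e1 e2
    have a0 := hax 0 a b c d hab hbc hcd hd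
    have a3 := hax 3 a b c d hab hbc hcd hd
    have a1 := hax 1 a b c d hab hbc hcd hd
    have a2 := hax 2 a b c d hab hbc hcd hd
    simp only [tri] at a0 a1 a2 a3
    cases q1 : Or p (tc a b c) <;> cases q2 : Or p (tc a b d) <;>
      cases q3 : Or p (tc a c d) <;> cases q4 : Or p (tc b c d) <;> simp_all
  · rcases lt_or_gt_of_ne hbd with hbd | hbd
    · -- `a c b d`
      rw [D_swap' (p a) (p c) (p b)] at h1
      rw [D_rot (p a) (p c) (p d), D_swap' (p c) (p b) (p d)] at h2
      have e1 := dec_eq (x := D (p a) (p c) (p b)) (y := D (p a) (p b) (p d)) (by linarith)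
      have e2 := dec_eq (x := D (p a) (p c) (p d)) (y := D (p c) (p b) (p d)) (by linarith)
      rw [← Or_tc p (by omega) (by omega), ← Or_tc p (by omega) (by omega)] at e1 e2
      exact (hg.2 a c b d hac hbc hbd hd).1 hcol ⟨e1, e2⟩
    · -- `a c d b`
      rw [D_swap' (p a) (p c) (p b), D_swap' (p a) (p d) (p b)] at h1
      rw [D_rot (p a) (p c) (p d)] at h2
      have e1 := dec_ne (x := D (p a) (p c) (p b)) (y := D (p a) (p d) (p b)) (by linarith)
      have e2 := dec_ne h2
      rw [← Or_tc p (by omega) (by omega), ← Or_tc p (by omega) (by omega)] at e1 e2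
      exact (hg.2 a c d b hac hcd hbd hb).2 hcol ⟨e1, e2⟩

theorem noX (p : ℕ → Pt) (hax : Axm (Or p)) {col : ℕ} (hg : Good (Or p) col) {a b c d : ℕ}
    (ha : a < 8) (hb : b < 8) (hc : c < 8) (hd : d < 8) (hab : a ≠ b) (hcd : c ≠ d)
    (hac : a ≠ c) (had : a ≠ d) (hbc : b ≠ c) (hbd : b ≠ d)
    (hcol : cc col a b = cc col c d) : ¬ X (p a) (p b) (p c) (p d) := by
  wlog h1 : a < b generalizing a b
  · intro h
    exact this hb ha hab.symm hbc hbd hac had (by rw [cc_comm, hcol]) (by omega) (X_swap1 h)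
  wlog h2 : c < d generalizing c d
  · intro h
    exact this hd hc hcd.symm had hac hbd hbc (by rw [hcol, cc_comm]) (by omega) (X_swap2 h)
  wlog h3 : a < c generalizing a b c d
  · intro h
    exact this (a := c) (b := d) (c := a) (d := b) (by assumption) (by assumption) (by assumption)
      h2 (by assumption) (by assumption) (by assumption) hac.symm hbc.symm had.symm hbd.symm
      hcol.symm h1 (by omega) (X_symm h)
  rw [cc_lt h1, cc_lt h2] at hcol
  exact noX_sorted p hax hg h1 h2 h3 hb hd hbc hbd hcol

/-- the colour classes as graphs -/
def cgraph {V : Type} (idx : V → ℕ) (col k : ℕ) : SimpleGraph V where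
  Adj a b := a ≠ b ∧ cc col (idx a) (idx b) = k
  symm := ⟨fun a b h => ⟨h.1.symm, by rw [cc_comm]; exact h.2⟩⟩
  loopless := ⟨fun a h => h.1 rfl⟩

theorem cgraph_connected {V : Type} (e : Fin 8 ≃ V) {col k : ℕ} (h : conn col k 7 1 = true) :
    (cgraph (fun v => (e.symm v).val) col k).Connected := by
  set G := cgraph (fun v => (e.symm v).val) col k with hG
  have key : ∀ i < 8, ∀ hi : i < 8, G.Reachable (e 0) (e ⟨i, hi⟩) := by
    refine conn_sound (Q := fun i => ∀ hi : i < 8, G.Reachable (e 0) (e ⟨i, hi⟩)) ?_ 7 1 ?_ h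
    · intro u v huv hv hk
      have hadj : G.Adj (e ⟨u, by omega⟩) (e ⟨v, hv⟩) := by
        refine ⟨fun h => ?_, ?_⟩
        · have := congrArg Fin.val (e.injective h)
          simp only at this
          omega
        · simp only [Equiv.symm_apply_apply]
          rw [cc_lt huv, hk]
      exact ⟨fun hu hi => (hu (by omega)).trans hadj.reachable,
        fun hv' hi => (hv' hv).trans hadj.symm.reachable⟩
    · intro i hi hi8
      have : i = 0 := by
        interval_cases i
        · rfl
        all_goals exact absurd hi (by decide)
      subst this
      exact SimpleGraph.Reachable.refl _
  have key' : ∀ v, G.Reachable (e 0) v := by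
    intro v
    have := key (e.symm v).val (e.symm v).isLt (e.symm v).isLt
    simpa using this
  have : Nonempty V := ⟨e 0⟩
  exact ⟨fun u v => (key' u).symm.trans (key' v)⟩

theorem cgraph_disjoint {V : Type} (idx : V → ℕ) (col : ℕ) {k l : ℕ} (h : k ≠ l) :
    Disjoint (cgraph idx col k).edgeSet (cgraph idx col l).edgeSet := by
  rw [Set.disjoint_left]
  intro s
  induction s using Sym2.ind with
  | _ a b =>
    intro h1 h2
    rw [SimpleGraph.mem_edgeSet] at h1 h2
    exact h (h1.2.symm.trans h2.2)

open Classical in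
theorem trees_of_connected {V : Type} [Fintype V] (hV : Fintype.card V = 8)
    (G : Fin 4 → SimpleGraph V) (hc : ∀ i, (G i).Connected)
    (hd : ∀ i j, i ≠ j → Disjoint (G i).edgeSet (G j).edgeSet) : ∀ i, (G i).IsTree := by
  have h1 : ∀ i, 7 ≤ (G i).edgeFinset.card := by
    intro i
    have := (hc i).card_vert_le_card_edgeSet_add_one
    rw [Nat.card_eq_fintype_card, hV, Nat.card_eq_fintype_card, ← SimpleGraph.edgeFinset_card] at this
    omega
  have h2 : ∑ i, (G i).edgeFinset.card ≤ 28 := by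
    rw [← Finset.card_biUnion]
    · have : (Finset.univ.biUnion fun i => (G i).edgeFinset) ⊆ (⊤ : SimpleGraph V).edgeFinset := by
        intro s hs
        rw [Finset.mem_biUnion] at hs
        obtain ⟨i, _, hs⟩ := hs
        exact SimpleGraph.edgeFinset_mono le_top hs
      refine (Finset.card_le_card this).trans ?_
      rw [SimpleGraph.card_edgeFinset_top_eq_card_choose_two, hV]
      decide
    · intro i _ j _ hij
      exact SimpleGraph.disjoint_edgeFinset.2 (SimpleGraph.disjoint_edgeSet.1 (hd i j hij))
  rw [Fin.sum_univ_four] at h2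
  intro i
  rw [SimpleGraph.isTree_iff_connected_and_card]
  refine ⟨hc i, ?_⟩
  rw [Nat.card_eq_fintype_card (α := V), hV, Nat.card_eq_fintype_card,
    ← SimpleGraph.edgeFinset_card]
  have := h1 0
  have := h1 1
  have := h1 2
  have := h1 3
  fin_cases i <;> simp only [] <;> first | omega | (simp; omega)

end FourTrees

open FourTrees in
/-- Every set of exactly 8 points in general position admits 4 pairwise edge-disjoint plane spanning trees. -/
theorem four_trees_eight_points (S : Finset Pt) (n : ℕ) (hS : S.card = n) (hgp : GenPos S)
    (hn : n = 8) :
    ∃ T : Fin 4 → SimpleGraph {x // x ∈ S},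
      (∀ i, IsPlaneSpanningTree (T i)) ∧
      (∀ i j, i ≠ j → Disjoint (T i).edgeSet (T j).edgeSet) := by
  subst hn
  have hD : ∀ p ∈ S, ∀ q ∈ S, ∀ r ∈ S, p ≠ q → p ≠ r → q ≠ r → D p q r ≠ 0 :=
    fun p hp q hq r hr hpq hpr hqr h => hgp p hp q hq r hr hpq hpr hqr (collinear_of_D hpq h)
  obtain ⟨e, he⟩ := label S hS hD
  let p : ℕ → Pt := fun i => (e (Fin.ofNat 8 i) : Pt)
  have hp : ∀ v : {x // x ∈ S}, p (e.symm v).val = v := by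
    intro v
    simp [p]
  have hDp : ∀ a b c, a < b → b < c → c < 8 → D (p a) (p b) (p c) ≠ 0 := by
    intro a b c hab hbc hc
    have inj : ∀ i j, i < j → j < 8 → p i ≠ p j := by
      intro i j hij hj h
      have h2 := congrArg Fin.val (e.injective (Subtype.ext h))
      simp only [Fin.val_ofNat] at h2
      omega
    exact hD _ (Subtype.prop _) _ (Subtype.prop _) _ (Subtype.prop _) (inj _ _ hab (by omega))
      (inj _ _ (by omega) hc) (inj _ _ hbc hc)
  have hpos : ∀ b c, 0 < b → b < c → c < 8 → 0 < D (p 0) (p b) (p c) := by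
    intro b c hb hbc hc
    refine he _ _ ?_ ?_
    · rw [Fin.lt_def]; simp only [Fin.val_ofNat, Fin.val_zero]; omega
    · rw [Fin.lt_def]; simp only [Fin.val_ofNat]; omega
  have hax := axm_Or p hDp hpos
  obtain ⟨col, hg⟩ := comb_main hax (fun b c hb hbc hc => by
    rw [Or_tc p (by omega) hc]; exact decide_eq_true (hpos b c hb hbc hc))
  let G : Fin 4 → SimpleGraph {x // x ∈ S} :=
    fun k => cgraph (fun v => (e.symm v).val) col k.val
  have hdis : ∀ i j, i ≠ j → Disjoint (G i).edgeSet (G j).edgeSet :=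
    fun i j hij => cgraph_disjoint _ col (fun h => hij (Fin.ext h))
  have hconn : ∀ i, (G i).Connected := fun i => cgraph_connected e (hg.1 i.val i.isLt)
  have htree := trees_of_connected (by simpa using hS) G hconn hdis
  refine ⟨G, fun k => ⟨htree k, ?_⟩, hdis⟩
  intro a b c d hab hcd hne
  -- the case of a common endpoint
  have share : ∀ x y z : {x // x ∈ S}, x ≠ y → x ≠ z → y ≠ z →
      openSegment ℝ (x : Pt) (y : Pt) ∩ openSegment ℝ (x : Pt) (z : Pt) = ∅ := by
    intro x y z hxy hxz hyz
    rw [Set.eq_empty_iff_forall_notMem]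
    rintro w ⟨h1, h2⟩
    obtain ⟨s, t, hs, ht, h⟩ := inter_rel h1 h2
    have h0 : D (x : Pt) (y : Pt) (x : Pt) = 0 := by unfold D; ring
    rw [h0, mul_zero, zero_add] at h
    rcases mul_eq_zero.1 h with h | h
    · linarith
    · exact hD _ x.2 _ y.2 _ z.2 (Subtype.coe_ne_coe.2 hxy) (Subtype.coe_ne_coe.2 hxz)
        (Subtype.coe_ne_coe.2 hyz) h
  have nab : a ≠ b := hab.1
  have ncd : c ≠ d := hcd.1
  by_cases hac : a = c
  · subst hac
    exact share a b d nab ncd (fun h => hne (by rw [h]))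
  by_cases had : a = d
  · subst had
    rw [openSegment_symm ℝ (c : Pt)]
    exact share a b c nab hac (fun h => hne (by rw [h, Sym2.eq_swap]))
  by_cases hbc : b = c
  · subst hbc
    rw [openSegment_symm ℝ (a : Pt)]
    exact share b a d nab.symm ncd had
  by_cases hbd : b = d
  · subst hbd
    rw [openSegment_symm ℝ (a : Pt), openSegment_symm ℝ (c : Pt)]
    exact share b a c nab.symm hbc hac
  rw [Set.eq_empty_iff_forall_notMem]
  rintro w ⟨h1, h2⟩
  have nid : ∀ x y : {x // x ∈ S}, x ≠ y → (e.symm x).val ≠ (e.symm y).val :=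
    fun x y h h' => h (e.symm.injective (Fin.ext h'))
  have hX : X (a : Pt) (b : Pt) (c : Pt) (d : Pt) := by
    constructor
    · obtain ⟨s, t, hs, ht, h⟩ := inter_rel h1 h2
      exact opp_of_rel hs ht h (hD _ a.2 _ b.2 _ c.2 (Subtype.coe_ne_coe.2 nab)
        (Subtype.coe_ne_coe.2 hac) (Subtype.coe_ne_coe.2 hbc))
    · obtain ⟨s, t, hs, ht, h⟩ := inter_rel h2 h1
      exact opp_of_rel hs ht h (hD _ c.2 _ d.2 _ a.2 (Subtype.coe_ne_coe.2 ncd)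
        (Subtype.coe_ne_coe.2 (Ne.symm hac)) (Subtype.coe_ne_coe.2 (Ne.symm had)))
  rw [← hp a, ← hp b, ← hp c, ← hp d] at hX
  exact noX p hax hg (e.symm a).isLt (e.symm b).isLt (e.symm c).isLt (e.symm d).isLt
    (nid _ _ nab) (nid _ _ ncd) (nid _ _ hac) (nid _ _ had) (nid _ _ hbc) (nid _ _ hbd)
    (hab.2.trans hcd.2.symm) hX
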